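/- arXiv:math/0505385 — 2 statements merged into one kernel-verified Lean document; each statement's English description precedes it below -/
import Mathlib

section
/- Let α ≥ 0, γ ≥ 0, σ > 0, β > 0 with ασ > γ². Then there exist constants b > 0, b' > 0 and times t₀ > 0, t₁ > 0 such that for all 0 < t ≤ t₀ and all (x,v,x₀,v₀) ∈ ℝ¹²: |∇_v G(t,x,v,x₀,v₀)| ≤ b t^{-1/2} G(t, x/2, v/2, x₀/2, v₀/2), and for all 0 < t ≤ t₁: |∇_x G(t,x,v,x₀,v₀)| ≤ b' t^{-1/2} G(t, x/2, v/2, x₀/2, v₀/2). -/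
open MeasureTheory Real Filter ENNReal RealInnerProductSpace

noncomputable section

abbrev E3 := EuclideanSpace ℝ (Fin 3)

/-- `λ(t)` of the Green's function. -/
def lamF (α β γ σ t : ℝ) : ℝ :=
  α * t + σ * ((Real.exp (2*β*t) - 4*Real.exp (β*t) + 3)/(2*β^3) + t/β^2)
    + γ * (2*t/β - 2*(Real.exp (β*t) - 1)/β^2)

/-- `ν(t)` of the Green's function. -/
def nuF (β σ t : ℝ) : ℝ := σ * (Real.exp (2*β*t) - 1)/(2*β)

/-- `μ(t)` of the Green's function. -/
def muF (β γ σ t : ℝ) : ℝ :=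
  σ * ((1 - Real.exp (β*t))/β)^2 + 2*γ*(1 - Real.exp (β*t))/β

/-- `f(t) = 4λ(t)ν(t) − μ(t)²`. -/
def fF (α β γ σ t : ℝ) : ℝ := 4 * lamF α β γ σ t * nuF β σ t - (muF β γ σ t)^2

/-- The Gaussian profile `F(t,x,v)`. -/
def FF (α β γ σ t : ℝ) (x v : E3) : ℝ :=
  ((2*π)^3)⁻¹ * (fF α β γ σ t) ^ (-(3:ℝ)/2) *
    Real.exp (-(nuF β σ t * ‖x‖^2 + lamF α β γ σ t * ‖v‖^2 + muF β γ σ t * ⟪x, v⟫)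
      / fF α β γ σ t)

/-- The Green's function of the linear Wigner-Fokker-Planck equation. -/
def Green (α β γ σ t : ℝ) (x v x₀ v₀ : E3) : ℝ :=
  Real.exp (3*β*t) *
    FF α β γ σ t (x + ((1 - Real.exp (β*t))/β) • v - x₀) (Real.exp (β*t) • v - v₀)

open scoped Topology

/-- The quadratic form in the exponent of `FF` dominates the squared norms: an explicit lower bound
on its smallest eigenvalue by determinant over trace. -/
lemma det_mul_le_trace_mul_form (N L M : ℝ) (X V : E3) :
    (4 * L * N - M ^ 2) * (‖X‖ ^ 2 + ‖V‖ ^ 2) ≤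
      4 * (N + L) * (N * ‖X‖ ^ 2 + L * ‖V‖ ^ 2 + M * ⟪X, V⟫) := by
  have h1 := norm_add_sq_real (N • X) ((M / 2) • V)
  have h2 := norm_add_sq_real (L • V) ((M / 2) • X)
  simp only [norm_smul, mul_pow, Real.norm_eq_abs, sq_abs, real_inner_smul_left,
    real_inner_smul_right, real_inner_comm X V] at h1 h2
  nlinarith [sq_nonneg ‖N • X + (M / 2) • V‖, sq_nonneg ‖L • V + (M / 2) • X‖]

/-- Gradient of a Gaussian composed with a pair of affine maps of homothety type. -/
lemma hasGradientAt_gaussian (K N L M f p q : ℝ) (A B w : E3) :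
    HasGradientAt (fun w : E3 => K * Real.exp (-(N * ‖p • w + A‖ ^ 2 + L * ‖q • w + B‖ ^ 2
        + M * ⟪p • w + A, q • w + B⟫) / f))
      (-(K * Real.exp (-(N * ‖p • w + A‖ ^ 2 + L * ‖q • w + B‖ ^ 2
        + M * ⟪p • w + A, q • w + B⟫) / f) / f) •
        ((2 * N * p + M * q) • (p • w + A) + (2 * L * q + M * p) • (q • w + B))) w := by
  have hX : HasFDerivAt (fun w : E3 => p • w + A) (p • ContinuousLinearMap.id ℝ E3) w :=
    ((hasFDerivAt_id w).const_smul p).add_const A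
  have hV : HasFDerivAt (fun w : E3 => q • w + B) (q • ContinuousLinearMap.id ℝ E3) w :=
    ((hasFDerivAt_id w).const_smul q).add_const B
  have h := ((((((hX.norm_sq.const_mul N).add (hV.norm_sq.const_mul L)).add
    ((hX.inner ℝ hV).const_mul M)).neg).mul_const f⁻¹).exp).const_mul K
  simp only [← div_eq_mul_inv] at h
  rw [hasGradientAt_iff_hasFDerivAt]
  refine h.congr_fderiv ?_
  ext z
  simp [inner_add_left, real_inner_smul_left, real_inner_smul_right, fderivInnerCLM_apply,
    inner_add_right, real_inner_comm z]
  ring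

/-- Absorbing a linear factor into part of a Gaussian. -/
lemma linear_mul_exp_le {S d t f Q P R c : ℝ} (hS : 0 < S) (hd : 0 < d) (ht : 0 < t)
    (hf : d * t ^ 2 ≤ f) (hP : 0 ≤ P) (hR : 0 ≤ R) (hQ : P ^ 2 + R ^ 2 ≤ 8 * S * t * Q)
    (hc : c ≤ 6 * S * t * (P + R)) :
    Real.exp (-Q) / f * c ≤
      6 * S / d * (1 + 16 * S) * t ^ (-(1 : ℝ) / 2) * Real.exp (-Q / 4) := by
  have hsq : t ^ (-(1 : ℝ) / 2) = (√t)⁻¹ := by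
    rw [Real.sqrt_eq_rpow, ← Real.rpow_neg ht.le]; norm_num
  have hr : 0 < √t := Real.sqrt_pos.2 ht
  have hrt : √t ^ 2 = t := Real.sq_sqrt ht.le
  have hf0 : 0 < f := lt_of_lt_of_le (by positivity) hf
  have hQ0 : 0 ≤ Q := by
    by_contra! h
    nlinarith [mul_pos hS ht, sq_nonneg P, sq_nonneg R, mul_pos (mul_pos hS ht) (neg_pos.2 h)]
  have hE : 1 + 3 * Q / 4 ≤ Real.exp (3 * Q / 4) := by
    linarith [Real.add_one_le_exp (3 * Q / 4)]
  have hexp : Real.exp (-Q / 4) = Real.exp (-Q) * Real.exp (3 * Q / 4) := by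
    rw [← Real.exp_add]; ring_nf
  have hlin : P + R ≤ √t * ((1 + 16 * S) * Real.exp (3 * Q / 4)) := by
    have h1 : P + R ≤ √t * (1 + 8 * S * Q) := by
      have h2 : (P + R) * √t ≤ t * (1 + 8 * S * Q) := by
        nlinarith [sq_nonneg (P - R), sq_nonneg (P + R - √t)]
      have h3 : √t * (P + R) ≤ √t * (√t * (1 + 8 * S * Q)) := by
        rw [← mul_assoc, ← sq, hrt]; linarith
      exact le_of_mul_le_mul_left h3 hr
    refine h1.trans (mul_le_mul_of_nonneg_left ?_ hr.le)
    nlinarith [mul_nonneg hS.le hQ0, mul_le_mul_of_nonneg_left hE (by positivity : 0 ≤ 1 + 16 * S)]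
  have hPR : 0 ≤ P + R := by positivity
  calc Real.exp (-Q) / f * c ≤ Real.exp (-Q) / f * (6 * S * t * (P + R)) := by gcongr
    _ ≤ Real.exp (-Q) / (d * t ^ 2) * (6 * S * t * (P + R)) := by gcongr
    _ ≤ Real.exp (-Q) / (d * t ^ 2) *
          (6 * S * t * (√t * ((1 + 16 * S) * Real.exp (3 * Q / 4)))) := by gcongr
    _ = _ := by
      rw [hsq, hexp]
      field_simp
      rw [hrt]

/-- Gradient bound for a Gaussian whose covariance coefficients are of order `t`. -/
lemma norm_gradient_gaussian_le {K N L M f p q S d t : ℝ} (A B w : E3) (hK : 0 ≤ K)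
    (hS : 0 < S) (hd : 0 < d) (ht : 0 < t) (hN : 0 < N) (hL : 0 < L) (hNS : N ≤ S * t)
    (hLS : L ≤ S * t) (hM : |M| ≤ S * t) (hf : f = 4 * L * N - M ^ 2) (hdf : d * t ^ 2 ≤ f)
    (hp : |p| ≤ 2) (hq : |q| ≤ 2) :
    ‖gradient (fun w : E3 => K * Real.exp (-(N * ‖p • w + A‖ ^ 2 + L * ‖q • w + B‖ ^ 2
        + M * ⟪p • w + A, q • w + B⟫) / f)) w‖ ≤
      6 * S / d * (1 + 16 * S) * t ^ (-(1 : ℝ) / 2) *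
        (K * Real.exp (-(N * ‖p • w + A‖ ^ 2 + L * ‖q • w + B‖ ^ 2
        + M * ⟪p • w + A, q • w + B⟫) / f / 4)) := by
  rw [(hasGradientAt_gaussian K N L M f p q A B w).gradient]
  have hf0 : 0 < f := lt_of_lt_of_le (by positivity) hdf
  set X := p • w + A
  set V := q • w + B
  set Q := (N * ‖X‖ ^ 2 + L * ‖V‖ ^ 2 + M * ⟪X, V⟫) / f with hQdef
  have hneg : -(N * ‖X‖ ^ 2 + L * ‖V‖ ^ 2 + M * ⟪X, V⟫) / f = -Q := by rw [hQdef]; ring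
  rw [hneg]
  have hQ : ‖X‖ ^ 2 + ‖V‖ ^ 2 ≤ 8 * S * t * Q := by
    have h := det_mul_le_trace_mul_form N L M X V
    rw [← hf] at h
    have h1 : ‖X‖ ^ 2 + ‖V‖ ^ 2 ≤ 4 * (N + L) * Q := by
      rw [hQdef, ← mul_div_assoc, le_div_iff₀ hf0]; linarith
    have hQ0 : 0 ≤ Q := by
      by_contra! hlt
      nlinarith [sq_nonneg ‖X‖, sq_nonneg ‖V‖, mul_pos (add_pos hN hL) (neg_pos.2 hlt)]
    nlinarith
  have hcoef : ∀ c a b : ℝ, 0 < c → c ≤ S * t → |a| ≤ 2 → |b| ≤ 2 →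
      |2 * c * a + M * b| ≤ 6 * S * t := by
    intro c a b hc hcS ha hb
    calc |2 * c * a + M * b| ≤ |2 * c * a| + |M * b| := abs_add_le _ _
      _ = 2 * c * |a| + |M| * |b| := by
        rw [abs_mul, abs_mul M, abs_of_pos (by positivity : 0 < 2 * c)]
      _ ≤ 2 * (S * t) * 2 + S * t * 2 := by gcongr
      _ = 6 * S * t := by ring
  have hc : ‖(2 * N * p + M * q) • X + (2 * L * q + M * p) • V‖ ≤
      6 * S * t * (‖X‖ + ‖V‖) := by
    refine (norm_add_le _ _).trans ?_
    rw [norm_smul, norm_smul, mul_add]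
    gcongr
    · exact hcoef N p q hN hNS hp hq
    · exact hcoef L q p hL hLS hq hp
  have hmain := linear_mul_exp_le hS hd ht hdf (norm_nonneg X) (norm_nonneg V) hQ hc
  rw [norm_smul, norm_neg, Real.norm_of_nonneg (by positivity)]
  calc _ = K * (Real.exp (-Q) / f * ‖(2 * N * p + M * q) • X + (2 * L * q + M * p) • V‖) := by
        ring
    _ ≤ _ := (mul_le_mul_of_nonneg_left hmain hK).trans_eq (by ring)

/-- The coefficients of the Green's function at short times. -/
lemma short_time_coefficients (α β γ σ : ℝ) (hσ : 0 < σ) (hβ : 0 < β) (hcoeff : γ ^ 2 < α * σ) :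
    ∃ S > 0, ∃ d > 0, ∃ T > 0, ∀ t : ℝ, 0 < t → t ≤ T →
      0 < nuF β σ t ∧ 0 < lamF α β γ σ t ∧ nuF β σ t ≤ S * t ∧ lamF α β γ σ t ≤ S * t ∧
      |muF β γ σ t| ≤ S * t ∧ d * t ^ 2 ≤ fF α β γ σ t ∧
      |(1 - Real.exp (β * t)) / β| ≤ 2 ∧ |Real.exp (β * t)| ≤ 2 := by
  have hα : 0 < α := by
    by_contra! h
    nlinarith [sq_nonneg γ]
  have hexp : ∀ c : ℝ, HasDerivAt (fun t : ℝ => Real.exp (c * t)) c 0 := fun c => by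
    simpa using ((hasDerivAt_id (0 : ℝ)).const_mul c).exp
  have hid := hasDerivAt_id (0 : ℝ)
  have hlam : HasDerivAt (lamF α β γ σ) α 0 := by
    have h := ((hid.const_mul α).add ((((((hexp (2 * β)).sub ((hexp β).const_mul 4)).add_const
      3).div_const (2 * β ^ 3)).add (hid.div_const (β ^ 2))).const_mul σ)).add
      ((((hid.const_mul 2).div_const β).sub
        ((((hexp β).sub_const 1).const_mul 2).div_const (β ^ 2))).const_mul γ)
    refine h.congr_deriv ?_
    field_simp
    ring
  have hnu : HasDerivAt (nuF β σ) σ 0 := by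
    have h := (((hexp (2 * β)).sub_const 1).const_mul σ).div_const (2 * β)
    refine h.congr_deriv ?_
    field_simp
  have hmu : HasDerivAt (muF β γ σ) (-2 * γ) 0 := by
    have h := (((((hexp β).const_sub 1).div_const β).pow 2).const_mul σ).add
      ((((hexp β).const_sub 1).const_mul (2 * γ)).div_const β)
    refine h.congr_deriv ?_
    simp
    field_simp
  have hle : 𝓝[>] (0 : ℝ) ≤ 𝓝[≠] 0 := nhdsWithin_mono _ fun x hx => ne_of_gt hx
  have key : ∀ {g : ℝ → ℝ} {a : ℝ}, HasDerivAt g a 0 → g 0 = 0 →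
      Tendsto (fun t => g t / t) (𝓝[>] 0) (𝓝 a) := by
    intro g a hg hg0
    refine ((hasDerivAt_iff_tendsto_slope.1 hg).mono_left hle).congr fun t => ?_
    simp [slope_def_field, hg0]
  have h1 := key hlam (by norm_num [lamF])
  have h2 := key hnu (by simp [nuF])
  have h3 := key hmu (by simp [muF])
  have h4 : Tendsto (fun t => 4 * (lamF α β γ σ t / t) * (nuF β σ t / t) - (muF β γ σ t / t) ^ 2)
      (𝓝[>] 0) (𝓝 (4 * α * σ - (-2 * γ) ^ 2)) := ((h1.const_mul 4).mul h2).sub (h3.pow 2)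
  have hE : Tendsto (fun t : ℝ => Real.exp (β * t)) (𝓝[>] 0) (𝓝 1) := by
    simpa using (hexp β).continuousAt.tendsto.mono_left nhdsWithin_le_nhds
  have hs : Tendsto (fun t : ℝ => |(1 - Real.exp (β * t)) / β|) (𝓝[>] 0) (𝓝 0) := by
    simpa using ((hE.const_sub 1).div_const β).abs
  have hδ : 2 * (α * σ - γ ^ 2) < 4 * α * σ - (-2 * γ) ^ 2 := by nlinarith
  have hev : ∀ᶠ t in 𝓝[>] (0 : ℝ),
      0 < nuF β σ t ∧ 0 < lamF α β γ σ t ∧ nuF β σ t ≤ (α + σ + 2 * |γ| + 1) * t ∧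
      lamF α β γ σ t ≤ (α + σ + 2 * |γ| + 1) * t ∧
      |muF β γ σ t| ≤ (α + σ + 2 * |γ| + 1) * t ∧
      2 * (α * σ - γ ^ 2) * t ^ 2 ≤ fF α β γ σ t ∧
      |(1 - Real.exp (β * t)) / β| ≤ 2 ∧ |Real.exp (β * t)| ≤ 2 := by
    have hγ := abs_nonneg γ
    filter_upwards [self_mem_nhdsWithin, h1.eventually_const_lt hα, h2.eventually_const_lt hσ,
      h1.eventually_lt_const (show α < α + σ + 2 * |γ| + 1 by linarith),
      h2.eventually_lt_const (show σ < α + σ + 2 * |γ| + 1 by linarith),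
      h3.abs.eventually_lt_const (show |-2 * γ| < α + σ + 2 * |γ| + 1 by
        rw [abs_mul]; norm_num; linarith),
      h4.eventually_const_lt hδ, hs.eventually_lt_const (show (0 : ℝ) < 2 by norm_num),
      hE.eventually_lt_const (show (1 : ℝ) < 2 by norm_num)] with t ht a1 a2 a3 a4 a5 a6 a7 a8
    have ht : 0 < t := ht
    rw [div_lt_iff₀ ht] at a3 a4
    rw [abs_div, abs_of_pos ht, div_lt_iff₀ ht] at a5
    refine ⟨?_, ?_, a4.le, a3.le, a5.le, ?_, a7.le, ?_⟩
    · simpa [ht] using a2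
    · simpa [ht] using a1
    · have : 4 * (lamF α β γ σ t / t) * (nuF β σ t / t) - (muF β γ σ t / t) ^ 2
          = fF α β γ σ t / t ^ 2 := by rw [fF]; field_simp
      rw [this, lt_div_iff₀ (by positivity)] at a6
      exact a6.le
    · rw [abs_of_pos (Real.exp_pos _)]; exact a8.le
  obtain ⟨T, hT, hsub⟩ := mem_nhdsGT_iff_exists_Ioc_subset.1 hev
  refine ⟨α + σ + 2 * |γ| + 1, by positivity, 2 * (α * σ - γ ^ 2), by linarith, T, hT,
    fun t ht htT => hsub ⟨ht, htT⟩⟩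

/-- The Green's function at halved arguments: the exponent is divided by four. -/
lemma green_half (α β γ σ t : ℝ) (x v x₀ v₀ : E3) :
    Green α β γ σ t ((2:ℝ)⁻¹ • x) ((2:ℝ)⁻¹ • v) ((2:ℝ)⁻¹ • x₀) ((2:ℝ)⁻¹ • v₀) =
      Real.exp (3 * β * t) * (((2 * π) ^ 3)⁻¹ * (fF α β γ σ t) ^ (-(3:ℝ) / 2)) *
        Real.exp (-(nuF β σ t * ‖x + ((1 - Real.exp (β*t))/β) • v - x₀‖ ^ 2
          + lamF α β γ σ t * ‖Real.exp (β*t) • v - v₀‖ ^ 2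
          + muF β γ σ t * ⟪x + ((1 - Real.exp (β*t))/β) • v - x₀, Real.exp (β*t) • v - v₀⟫)
          / fF α β γ σ t / 4) := by
  have hX : (2:ℝ)⁻¹ • x + ((1 - Real.exp (β*t))/β) • (2:ℝ)⁻¹ • v - (2:ℝ)⁻¹ • x₀ =
      (2:ℝ)⁻¹ • (x + ((1 - Real.exp (β*t))/β) • v - x₀) := by module
  have hV : Real.exp (β*t) • (2:ℝ)⁻¹ • v - (2:ℝ)⁻¹ • v₀ =
      (2:ℝ)⁻¹ • (Real.exp (β*t) • v - v₀) := by module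
  rw [Green, FF, hX, hV, mul_assoc]
  simp only [norm_smul, real_inner_smul_left, real_inner_smul_right, mul_pow, Real.norm_eq_abs,
    sq_abs]
  ring_nf

/-- Pointwise short-time bounds on the gradients of the Green's function:
`|∇_v G| ≤ b t^{−1/2} G(t,·/2)` and `|∇_x G| ≤ b' t^{−1/2} G(t,·/2)`. -/
theorem green_gradient_bounds (α β γ σ : ℝ) (hα : 0 ≤ α) (hγ : 0 ≤ γ) (hσ : 0 < σ)
    (hβ : 0 < β) (hcoeff : γ^2 < α*σ) :
    ∃ b : ℝ, 0 < b ∧ ∃ b' : ℝ, 0 < b' ∧ ∃ t₀ : ℝ, 0 < t₀ ∧ ∃ t₁ : ℝ, 0 < t₁ ∧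
      (∀ t : ℝ, 0 < t → t ≤ t₀ → ∀ x v x₀ v₀ : E3,
        ‖gradient (fun v' : E3 => Green α β γ σ t x v' x₀ v₀) v‖ ≤
          b * t ^ (-(1:ℝ)/2) *
            Green α β γ σ t ((2:ℝ)⁻¹ • x) ((2:ℝ)⁻¹ • v) ((2:ℝ)⁻¹ • x₀) ((2:ℝ)⁻¹ • v₀)) ∧
      (∀ t : ℝ, 0 < t → t ≤ t₁ → ∀ x v x₀ v₀ : E3,
        ‖gradient (fun x' : E3 => Green α β γ σ t x' v x₀ v₀) x‖ ≤
          b' * t ^ (-(1:ℝ)/2) *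
            Green α β γ σ t ((2:ℝ)⁻¹ • x) ((2:ℝ)⁻¹ • v) ((2:ℝ)⁻¹ • x₀) ((2:ℝ)⁻¹ • v₀)) := by
  obtain ⟨S, hS, d, hd, T, hT, H⟩ := short_time_coefficients α β γ σ hσ hβ hcoeff
  have hb : 0 < 6 * S / d * (1 + 16 * S) := by positivity
  have hK : ∀ t, 0 < t → t ≤ T →
      0 ≤ Real.exp (3 * β * t) * (((2 * π) ^ 3)⁻¹ * (fF α β γ σ t) ^ (-(3:ℝ) / 2)) := by
    intro t ht htT
    obtain ⟨-, -, -, -, -, hf, -⟩ := H t ht htT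
    have : 0 ≤ fF α β γ σ t := le_trans (by positivity) hf
    positivity
  refine ⟨_, hb, _, hb, T, hT, T, hT, ?_, ?_⟩
  · intro t ht htT x v x₀ v₀
    obtain ⟨hN, hL, hNS, hLS, hM, hf, hp, hq⟩ := H t ht htT
    have h := norm_gradient_gaussian_le (x - x₀) (-v₀) v (hK t ht htT) hS hd ht hN hL hNS hLS hM
      (by rw [fF]) hf hp hq
    have hX : ∀ w : E3, ((1 - Real.exp (β*t))/β) • w + (x - x₀) =
      x + ((1 - Real.exp (β*t))/β) • w - x₀ := fun w => by abel
    simp only [hX, ← sub_eq_add_neg] at h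
    rw [green_half]
    simpa only [Green, FF, mul_assoc] using h
  · intro t ht htT x v x₀ v₀
    obtain ⟨hN, hL, hNS, hLS, hM, hf, -, -⟩ := H t ht htT
    have h := norm_gradient_gaussian_le (p := 1) (q := 0)
      (((1 - Real.exp (β*t))/β) • v - x₀) (Real.exp (β*t) • v - v₀) x
      (hK t ht htT) hS hd ht hN hL hNS hLS hM (by rw [fF]) hf (by norm_num) (by norm_num)
    simp only [one_smul, zero_smul, zero_add, ← add_sub_assoc] at h
    rw [green_half]
    simpa only [Green, FF, mul_assoc] using h

end
end

section
/- Let α ≥ 0, γ ≥ 0, σ > 0, β > 0 with ασ > γ², and set κ := 3β/2 + 9σ. Then there exist constants B > 0 and T₀ > 0, depending only on α, β, γ, σ, such that for every measurable w₀ : ℝ³×ℝ³ → ℝ with ‖w₀‖_X < ∞ and every t ∈ (0, T₀], the function w(t,x,v) := ∫_{ℝ³}∫_{ℝ³} G(t,x,v,x₀,v₀) w₀(x₀,v₀) dx₀ dv₀ (the solution of the linear Wigner-Fokker-Planck equation with initial datum w₀) is differentiable in x and v and satisfies ‖∇_v w(t,·,·)‖_X ≤ B t^{-1/2} e^{κ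 t} ‖w₀‖_X and ‖∇_x w(t,·,·)‖_X ≤ B t^{-1/2} e^{κ t} ‖w₀‖_X. -/
open MeasureTheory Real Filter ENNReal RealInnerProductSpace

noncomputable section

/-- The solution of the linear Wigner-Fokker-Planck equation with initial datum `w₀`. -/
def sol (α β γ σ : ℝ) (w₀ : E3 × E3 → ℝ) (t : ℝ) (x v : E3) : ℝ :=
  ∫ q : E3 × E3, Green α β γ σ t x v q.1 q.2 * w₀ q

/-- The weighted `X`-norm `‖w‖_X = (∫∫ |w(x,v)|² (1+|v|²)² dx dv)^{1/2}`. -/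
def Xnorm (w : E3 × E3 → ℝ) : ℝ≥0∞ :=
  (∫⁻ p : E3 × E3, (‖w p‖₊ : ℝ≥0∞) ^ 2 * ENNReal.ofReal ((1 + ‖p.2‖ ^ 2) ^ 2)) ^ (1/2 : ℝ)

instance isAddRightInvariant_volume_phase :
    (volume : Measure (E3 × E3)).IsAddRightInvariant := by
  rw [Measure.volume_eq_prod]; infer_instance

/-- The isotropic Gaussian `exp(-k(|x|² + |v|²))` on phase space. -/
def phaseGaussian (k : ℝ) (z : E3 × E3) : ℝ := Real.exp (-k * (‖z.1‖ ^ 2 + ‖z.2‖ ^ 2))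

lemma continuous_phaseGaussian (k : ℝ) : Continuous (phaseGaussian k) := by
  unfold phaseGaussian; fun_prop

lemma phaseGaussian_pos (k : ℝ) (z : E3 × E3) : 0 < phaseGaussian k z := Real.exp_pos _

lemma phaseGaussian_sub_comm (k : ℝ) (z q : E3 × E3) :
    phaseGaussian k (z - q) = phaseGaussian k (q - z) := by
  simp [phaseGaussian, norm_sub_rev]

lemma phaseGaussian_eq_mul (k : ℝ) (z : E3 × E3) :
    phaseGaussian k z = Real.exp (-k * ‖z.1‖ ^ 2) * Real.exp (-k * ‖z.2‖ ^ 2) := by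
  rw [phaseGaussian, ← Real.exp_add]; ring_nf

lemma integrable_exp_neg_mul_sq_norm {k : ℝ} (hk : 0 < k) :
    Integrable (fun v : E3 => Real.exp (-k * ‖v‖ ^ 2)) := by
  by_contra h
  have h1 := GaussianFourier.integral_rexp_neg_mul_sq_norm (V := E3) hk
  rw [integral_undef h] at h1
  have : 0 < (π / k) ^ ((Module.finrank ℝ E3 : ℝ) / 2) := by positivity
  linarith

lemma integrable_phaseGaussian {k : ℝ} (hk : 0 < k) : Integrable (phaseGaussian k) := by
  have h := (integrable_exp_neg_mul_sq_norm hk).mul_prod (integrable_exp_neg_mul_sq_norm hk)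
  exact h.congr (Eventually.of_forall fun z => (phaseGaussian_eq_mul k z).symm)

lemma integral_phaseGaussian {k : ℝ} (hk : 0 < k) :
    ∫ z, phaseGaussian k z = (π / k) ^ 3 := by
  have h := integral_prod_mul (μ := (volume : Measure E3)) (ν := (volume : Measure E3))
    (fun v : E3 => Real.exp (-k * ‖v‖ ^ 2)) (fun v : E3 => Real.exp (-k * ‖v‖ ^ 2))
  simp_rw [phaseGaussian_eq_mul]
  rw [Measure.volume_eq_prod, h, GaussianFourier.integral_rexp_neg_mul_sq_norm hk,
    ← Real.rpow_add (by positivity), ← Real.rpow_natCast]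
  congr 1
  simp

lemma lintegral_phaseGaussian {k : ℝ} (hk : 0 < k) :
    ∫⁻ z, ENNReal.ofReal (phaseGaussian k z) = ENNReal.ofReal ((π / k) ^ 3) := by
  rw [← integral_phaseGaussian hk, ofReal_integral_eq_lintegral_ofReal
    (integrable_phaseGaussian hk) (Eventually.of_forall fun z => (phaseGaussian_pos k z).le)]

/-- Moving the centre of a Gaussian by at most one costs a constant and half of the rate. -/
lemma phaseGaussian_le_of_norm_sub_le {k : ℝ} (hk : 0 ≤ k) {z z₀ : E3 × E3}
    (h : ‖z - z₀‖ ≤ 1) :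
    phaseGaussian k z ≤ Real.exp (2 * k) * phaseGaussian (k / 2) z₀ := by
  rw [phaseGaussian, phaseGaussian, ← Real.exp_add]
  apply Real.exp_le_exp.2
  have key : ∀ x y : E3, ‖x - y‖ ≤ 1 → ‖y‖ ^ 2 ≤ 2 * ‖x‖ ^ 2 + 2 := by
    intro x y hxy
    have h1 : ‖y‖ ≤ ‖x‖ + 1 := by
      have := norm_sub_norm_le y x
      rw [norm_sub_rev] at this
      linarith
    nlinarith [norm_nonneg x, norm_nonneg y, sq_nonneg (‖x‖ - 1)]
  have h1 := key z.1 z₀.1 ((norm_fst_le (z - z₀)).trans h)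
  have h2 := key z.2 z₀.2 ((norm_snd_le (z - z₀)).trans h)
  nlinarith

/-- Schur's test in `L²`. -/
lemma lintegral_sq_lintegral_mul_le {X Y : Type*} [MeasurableSpace X] [MeasurableSpace Y]
    {μ : Measure X} {ν : Measure Y} [SFinite μ] [SFinite ν] {k : X → Y → ℝ≥0∞}
    (hk : Measurable (Function.uncurry k)) {h : Y → ℝ≥0∞} (hh : Measurable h) {I : ℝ≥0∞}
    (hrow : ∀ x, ∫⁻ y, k x y ∂ν ≤ I) (hcol : ∀ y, ∫⁻ x, k x y ∂μ ≤ I) :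
    ∫⁻ x, (∫⁻ y, k x y * h y ∂ν) ^ 2 ∂μ ≤ I ^ 2 * ∫⁻ y, h y ^ 2 ∂ν := by
  have hkx : ∀ x, Measurable (k x) := fun x => hk.comp measurable_prodMk_left
  have cs : ∀ x, (∫⁻ y, k x y * h y ∂ν) ^ 2 ≤ I * ∫⁻ y, k x y * h y ^ 2 ∂ν := by
    intro x
    have hhalf : ∀ a : ℝ≥0∞, (a ^ (1/2 : ℝ)) ^ 2 = a := fun a => by
      rw [← ENNReal.rpow_natCast, ← ENNReal.rpow_mul]; norm_num
    have h1 := ENNReal.lintegral_mul_le_Lp_mul_Lq ν Real.HolderConjugate.two_two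
      (f := fun y => k x y ^ (1/2 : ℝ)) (g := fun y => k x y ^ (1/2 : ℝ) * h y)
      ((hkx x).pow_const _).aemeasurable (((hkx x).pow_const _).mul hh).aemeasurable
    have e1 : ∀ y, ((fun y => k x y ^ (1/2 : ℝ)) * (fun y => k x y ^ (1/2 : ℝ) * h y)) y
        = k x y * h y := fun y => by
      rw [Pi.mul_apply, ← mul_assoc, ← sq, hhalf]
    simp_rw [e1, ENNReal.rpow_two, mul_pow, hhalf] at h1
    calc (∫⁻ y, k x y * h y ∂ν) ^ 2
        ≤ ((∫⁻ y, k x y ∂ν) ^ (1/2 : ℝ) * (∫⁻ y, k x y * h y ^ 2 ∂ν) ^ (1/2 : ℝ)) ^ 2 := by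
          gcongr
      _ = (∫⁻ y, k x y ∂ν) * ∫⁻ y, k x y * h y ^ 2 ∂ν := by rw [mul_pow, hhalf, hhalf]
      _ ≤ _ := by gcongr; exact hrow x
  have hm : Measurable (Function.uncurry fun x y => k x y * h y ^ 2) :=
    hk.mul ((hh.comp measurable_snd).pow_const 2)
  calc ∫⁻ x, (∫⁻ y, k x y * h y ∂ν) ^ 2 ∂μ
      ≤ ∫⁻ x, I * ∫⁻ y, k x y * h y ^ 2 ∂ν ∂μ := lintegral_mono cs
    _ = I * ∫⁻ y, ∫⁻ x, k x y * h y ^ 2 ∂μ ∂ν := by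
        rw [lintegral_const_mul _ (Measurable.lintegral_prod_right' (f := fun p : X × Y =>
          k p.1 p.2 * h p.2 ^ 2) hm), lintegral_lintegral_swap hm.aemeasurable]
    _ = I * ∫⁻ y, (∫⁻ x, k x y ∂μ) * h y ^ 2 ∂ν := by
        congr 1
        refine lintegral_congr fun y => ?_
        exact lintegral_mul_const (h y ^ 2) (hk.comp (measurable_prodMk_right (y := y)))
    _ ≤ I * ∫⁻ y, I * h y ^ 2 ∂ν := by gcongr with y; exact hcol y
    _ = _ := by rw [lintegral_const_mul _ (hh.pow_const 2)]; ring

/-- The linear change of phase-space variables `(x, v) ↦ (x + cv, ev)`. -/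
def shear (c e : ℝ) (p : E3 × E3) : E3 × E3 := (p.1 + c • p.2, e • p.2)

lemma continuous_shear (c e : ℝ) : Continuous (shear c e) := by
  unfold shear; fun_prop

lemma lintegral_comp_smul_le {e : ℝ} (he : 1 ≤ e) {g : E3 → ℝ≥0∞} (hg : Measurable g) :
    ∫⁻ v, g (e • v) ≤ ∫⁻ v, g v := by
  have he0 : e ≠ 0 := by positivity
  rw [← lintegral_map hg (measurable_const_smul e), Measure.map_addHaar_smul _ he0,
    lintegral_smul_measure]
  refine (mul_le_mul_left ?_ _).trans_eq (one_mul _)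
  rw [ENNReal.ofReal_le_one, abs_of_nonneg (by positivity)]
  exact inv_le_one_of_one_le₀ (one_le_pow₀ he)

lemma lintegral_shear_sub_le (c : ℝ) {e : ℝ} (he : 1 ≤ e) {g : E3 × E3 → ℝ≥0∞}
    (hg : Measurable g) (q : E3 × E3) :
    ∫⁻ p, g (shear c e p - q) ≤ ∫⁻ z, g z := by
  have hm : Measurable fun p => g (shear c e p - q) :=
    hg.comp ((continuous_shear c e).measurable.sub_const q)
  rw [Measure.volume_eq_prod, lintegral_prod_symm _ hm.aemeasurable,
    lintegral_prod_symm _ hg.aemeasurable]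
  have h1 : ∀ v : E3, ∫⁻ x : E3, g (shear c e (x, v) - q) = ∫⁻ x : E3, g (x, e • v - q.2) := by
    intro v
    rw [← lintegral_add_right_eq_self (fun x : E3 => g (x, e • v - q.2)) (c • v - q.1)]
    refine lintegral_congr fun x => ?_
    congr 1
    ext1
    · simp [shear, add_sub_assoc]
    · simp [shear]
  simp_rw [h1]
  have hm2 : Measurable fun v : E3 => ∫⁻ x : E3, g (x, v) := hg.lintegral_prod_left'
  calc ∫⁻ v : E3, ∫⁻ x : E3, g (x, e • v - q.2)
      ≤ ∫⁻ v : E3, ∫⁻ x : E3, g (x, v - q.2) :=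
        lintegral_comp_smul_le (g := fun v => ∫⁻ x : E3, g (x, v - q.2)) he
          (hm2.comp (measurable_id.sub_const q.2))
    _ = _ := lintegral_sub_right_eq_self (fun v => ∫⁻ x : E3, g (x, v)) q.2

/-- Differentiation under the integral sign for a convolution whose kernel and its derivative are
dominated by a Gaussian, against a square integrable function. -/
lemma hasFDerivAt_integral_sub_mul {φ : E3 × E3 → ℝ} (hφ : ContDiff ℝ 1 φ) {C k : ℝ}
    (hk : 0 < k) (hb : ∀ z, |φ z| ≤ C * phaseGaussian k z)
    (hb' : ∀ z, ‖fderiv ℝ φ z‖ ≤ C * phaseGaussian k z) {w : E3 × E3 → ℝ} (hw : Measurable w)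
    (hw2 : Integrable fun q => w q ^ 2) (z : E3 × E3) :
    HasFDerivAt (fun z => ∫ q, φ (z - q) * w q) (∫ q, w q • fderiv ℝ φ (z - q)) z := by
  have hC : 0 ≤ C := by
    have := (abs_nonneg _).trans (hb 0)
    exact nonneg_of_mul_nonneg_left this (phaseGaussian_pos k 0)
  have hgw : ∀ j, 0 < j → ∀ z, Integrable fun q => phaseGaussian j (z - q) * |w q| := by
    intro j hj z
    have hsq : Integrable fun q => phaseGaussian (2 * j) (z - q) :=
      ((integrable_phaseGaussian (by positivity : 0 < 2 * j)).comp_sub_right z).congr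
        (Eventually.of_forall fun q => phaseGaussian_sub_comm _ q z)
    refine (hsq.add hw2).mono' ?_ (Eventually.of_forall fun q => ?_)
    · exact (((continuous_phaseGaussian j).measurable.comp
        (measurable_const.sub measurable_id)).mul hw.abs).aestronglyMeasurable
    · have h2 : phaseGaussian (2 * j) (z - q) = phaseGaussian j (z - q) ^ 2 := by
        rw [phaseGaussian, phaseGaussian, ← Real.exp_nat_mul]; congr 1; push_cast; ring
      have := phaseGaussian_pos j (z - q)
      rw [Real.norm_eq_abs, abs_of_nonneg (by positivity), Pi.add_apply, h2, ← sq_abs (w q)]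
      nlinarith [sq_nonneg (phaseGaussian j (z - q) - |w q|), abs_nonneg (w q)]
  have hmeas : ∀ z, AEStronglyMeasurable (fun q => φ (z - q) * w q) volume := fun z =>
    ((hφ.continuous.measurable.comp (measurable_const.sub measurable_id)).mul
      hw).aestronglyMeasurable
  have hcont' : Continuous (fderiv ℝ φ) := hφ.continuous_fderiv (by norm_num)
  refine hasFDerivAt_integral_of_dominated_of_fderiv_le
    (F' := fun z q => w q • fderiv ℝ φ (z - q))
    (bound := fun q => C * Real.exp (2 * k) * (phaseGaussian (k / 2) (z - q) * |w q|))
    (Metric.closedBall_mem_nhds z one_pos) (Eventually.of_forall hmeas) ?_ ?_ ?_ ?_ ?_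
  · refine ((hgw k hk z).const_mul C).mono' (hmeas z) (Eventually.of_forall fun q => ?_)
    rw [norm_mul, Real.norm_eq_abs, Real.norm_eq_abs, ← mul_assoc]
    gcongr
    exact hb _
  · exact hw.aestronglyMeasurable.smul
      (hcont'.comp (continuous_const.sub continuous_id)).aestronglyMeasurable
  · refine Eventually.of_forall fun q y hy => ?_
    rw [norm_smul, Real.norm_eq_abs, mul_comm, ← mul_assoc]
    gcongr
    refine (hb' _).trans ?_
    rw [mul_assoc]
    gcongr
    apply phaseGaussian_le_of_norm_sub_le hk.le
    simpa [dist_eq_norm] using hy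
  · exact (hgw (k / 2) (by positivity) z).const_mul _
  · refine Eventually.of_forall fun q y _ => ?_
    have h1 : HasFDerivAt φ (fderiv ℝ φ (y - q)) (y - q) :=
      (hφ.differentiable (by norm_num) _).hasFDerivAt
    have h2 : HasFDerivAt (fun y => φ (y - q)) (fderiv ℝ φ (y - q)) y := by
      exact h1.comp y ((hasFDerivAt_id y).sub_const q)
    exact h2.mul_const (w q)

/-- Exponent of a general Gaussian on phase space. -/
def quadExp (n l m f : ℝ) (z : E3 × E3) : ℝ :=
  -(n * ‖z.1‖ ^ 2 + l * ‖z.2‖ ^ 2 + m * ⟪z.1, z.2⟫) / f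

lemma contDiff_quadExp (n l m f : ℝ) : ContDiff ℝ 1 (quadExp n l m f) := by
  unfold quadExp
  exact (((contDiff_const.mul (contDiff_fst.norm_sq ℝ)).add
    (contDiff_const.mul (contDiff_snd.norm_sq ℝ))).add
    (contDiff_const.mul (contDiff_fst.inner ℝ contDiff_snd))).neg.div_const f

lemma norm_fderiv_quadExp_le (n l m : ℝ) {f : ℝ} (hf : 0 < f) (z : E3 × E3) :
    ‖fderiv ℝ (quadExp n l m f) z‖ ≤ 2 * (|n| + |l| + |m|) / f * ‖z‖ := by
  have h1 : HasFDerivAt (fun z : E3 × E3 => z.1) (ContinuousLinearMap.fst ℝ E3 E3) z :=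
    hasFDerivAt_fst
  have h2 : HasFDerivAt (fun z : E3 × E3 => z.2) (ContinuousLinearMap.snd ℝ E3 E3) z :=
    hasFDerivAt_snd
  have h := ((((h1.norm_sq.const_mul n).add (h2.norm_sq.const_mul l)).add
    ((h1.inner ℝ h2).const_mul m)).neg).mul_const f⁻¹
  have h' : HasFDerivAt (quadExp n l m f) _ z := h
  rw [h'.fderiv]
  refine ContinuousLinearMap.opNorm_le_bound _ (by positivity) fun y => ?_
  simp only [smul_apply, neg_apply,
    add_apply, ContinuousLinearMap.comp_apply, innerSL_apply_apply,
    ContinuousLinearMap.coe_fst', ContinuousLinearMap.coe_snd', fderivInnerCLM_apply,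
    ContinuousLinearMap.prod_apply, smul_eq_mul, nsmul_eq_mul, Nat.cast_ofNat]
  have bd : ∀ a b : E3, ‖a‖ ≤ ‖z‖ → ‖b‖ ≤ ‖y‖ → |⟪a, b⟫| ≤ ‖z‖ * ‖y‖ := fun a b ha hb =>
    (abs_real_inner_le_norm a b).trans (mul_le_mul ha hb (norm_nonneg _) (norm_nonneg _))
  have b1 := bd z.1 y.1 (norm_fst_le z) (norm_fst_le y)
  have b2 := bd z.2 y.2 (norm_snd_le z) (norm_snd_le y)
  have b3 := bd z.1 y.2 (norm_fst_le z) (norm_snd_le y)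
  have b4 := bd z.2 y.1 (norm_snd_le z) (norm_fst_le y)
  rw [real_inner_comm] at b4
  rw [norm_mul, norm_neg, Real.norm_eq_abs, Real.norm_eq_abs, abs_inv, abs_of_pos hf]
  have key : |n * (2 * ⟪z.1, y.1⟫) + l * (2 * ⟪z.2, y.2⟫) + m * (⟪z.1, y.2⟫ + ⟪y.1, z.2⟫)|
      ≤ 2 * (|n| + |l| + |m|) * (‖z‖ * ‖y‖) := by
    refine (abs_add_three _ _ _).trans ?_
    simp only [abs_mul, abs_two]
    have := (abs_add_le ⟪z.1, y.2⟫ ⟪y.1, z.2⟫).trans (add_le_add b3 b4)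
    have e1 := mul_le_mul_of_nonneg_left b1 (abs_nonneg n)
    have e2 := mul_le_mul_of_nonneg_left b2 (abs_nonneg l)
    have e3 := mul_le_mul_of_nonneg_left this (abs_nonneg m)
    linarith
  calc f⁻¹ * _ ≤ f⁻¹ * (2 * (|n| + |l| + |m|) * (‖z‖ * ‖y‖)) := by gcongr
    _ = _ := by ring

/-- A quadratic form is bounded below by its determinant over its trace. -/
lemma quadExp_le {n l m f : ℝ} (hf : 0 < f) (hdet : f = 4 * l * n - m ^ 2) (hn : 0 < n)
    (z : E3 × E3) :
    quadExp n l m f z ≤ -(1 / (4 * (n + l))) * (‖z.1‖ ^ 2 + ‖z.2‖ ^ 2) := by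
  have hl : 0 < l := by
    by_contra! h
    nlinarith [sq_nonneg m, mul_nonneg hn.le (neg_nonneg.2 h)]
  have s1 : ‖(2 * n) • z.1 + m • z.2‖ ^ 2
      = 4 * n ^ 2 * ‖z.1‖ ^ 2 + 4 * n * m * ⟪z.1, z.2⟫ + m ^ 2 * ‖z.2‖ ^ 2 := by
    rw [norm_add_sq_real, norm_smul, norm_smul, inner_smul_left, inner_smul_right, mul_pow,
      mul_pow, Real.norm_eq_abs, Real.norm_eq_abs, sq_abs, sq_abs]
    simp; ring
  have s2 : ‖m • z.1 + (2 * l) • z.2‖ ^ 2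
      = m ^ 2 * ‖z.1‖ ^ 2 + 4 * l * m * ⟪z.1, z.2⟫ + 4 * l ^ 2 * ‖z.2‖ ^ 2 := by
    rw [norm_add_sq_real, norm_smul, norm_smul, inner_smul_left, inner_smul_right, mul_pow,
      mul_pow, Real.norm_eq_abs, Real.norm_eq_abs, sq_abs, sq_abs]
    simp; ring
  rw [quadExp, neg_div, neg_mul, neg_le_neg_iff, one_div, inv_mul_eq_div,
    div_le_div_iff₀ (by positivity) hf, hdet]
  nlinarith [sq_nonneg ‖(2 * n) • z.1 + m • z.2‖, sq_nonneg ‖m • z.1 + (2 * l) • z.2‖]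

/-- The linear factor `‖z‖` and the weight are absorbed by half of the Gaussian. -/
lemma norm_mul_weight_mul_phaseGaussian_le {k t : ℝ} (hk : 0 < k) (ht : 0 < t) (ht1 : t ≤ 1)
    (z : E3 × E3) :
    ‖z‖ * (1 + ‖z.2‖ ^ 2) * phaseGaussian (k / t) z
      ≤ (1 + 4 / k) ^ 2 * Real.sqrt t * phaseGaussian (k / 2 / t) z := by
  set N := ‖z.1‖ ^ 2 + ‖z.2‖ ^ 2 with hN
  have hN0 : 0 ≤ N := by positivity
  set u := N / t with hu
  have hu0 : 0 ≤ u := by positivity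
  have hNu : N = t * u := by rw [hu]; field_simp
  have hz : ‖z‖ ≤ Real.sqrt t * (1 + u) := by
    have h1 : ‖z‖ ≤ Real.sqrt N := by
      refine max_le ?_ ?_ <;> refine Real.le_sqrt_of_sq_le ?_ <;> rw [hN] <;> nlinarith [
        sq_nonneg ‖z.1‖, sq_nonneg ‖z.2‖]
    rw [hNu, Real.sqrt_mul ht.le] at h1
    refine h1.trans ?_
    gcongr
    exact Real.sqrt_le_iff.2 ⟨by positivity, by nlinarith⟩
  have hw : 1 + ‖z.2‖ ^ 2 ≤ 1 + u := by
    have : ‖z.2‖ ^ 2 ≤ N := by rw [hN]; nlinarith [sq_nonneg ‖z.1‖]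
    nlinarith
  have hexp : 1 + u ≤ (1 + 4 / k) * Real.exp (k * u / 4) := by
    have h1 := Real.add_one_le_exp (k * u / 4)
    have h2 : 1 + u ≤ (1 + 4 / k) * (k * u / 4 + 1) := by
      have : (1 + 4 / k) * (k * u / 4 + 1) = 1 + u + (k * u / 4 + 4 / k) := by
        field_simp; ring
      have : 0 ≤ k * u / 4 + 4 / k := by positivity
      linarith
    exact h2.trans (by gcongr)
  have hG : phaseGaussian (k / 2 / t) z
      = Real.exp (k * u / 4) ^ 2 * phaseGaussian (k / t) z := by
    rw [phaseGaussian, phaseGaussian, ← Real.exp_nat_mul, ← Real.exp_add, ← hN, hu]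
    congr 1
    push_cast
    field_simp
    ring
  rw [hG]
  have hpos := phaseGaussian_pos (k / t) z
  calc ‖z‖ * (1 + ‖z.2‖ ^ 2) * phaseGaussian (k / t) z
      ≤ Real.sqrt t * (1 + u) * (1 + u) * phaseGaussian (k / t) z := by gcongr
    _ = Real.sqrt t * (1 + u) ^ 2 * phaseGaussian (k / t) z := by ring
    _ ≤ Real.sqrt t * ((1 + 4 / k) * Real.exp (k * u / 4)) ^ 2 * phaseGaussian (k / t) z := by
        gcongr
    _ = _ := by ring

lemma exists_coefficient_bounds (α β γ σ : ℝ) (hσ : 0 < σ)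
    (hβ : 0 < β) (hcoeff : γ^2 < α*σ) :
    ∃ M : ℝ, 0 < M ∧ ∃ d : ℝ, 0 < d ∧ ∃ T : ℝ, 0 < T ∧ ∀ t, 0 < t → t ≤ T →
      0 < nuF β σ t ∧ |nuF β σ t| ≤ M * t ∧ |lamF α β γ σ t| ≤ M * t ∧ |muF β γ σ t| ≤ M * t ∧
      d * t ^ 2 ≤ fF α β γ σ t := by
  have slope : ∀ {g : ℝ → ℝ} {g' : ℝ}, HasDerivAt g g' 0 → g 0 = 0 →
      Tendsto (fun t => g t / t) (nhdsWithin 0 (Set.Ioi 0)) (nhds g') := by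
    intro g g' h h0
    have := (hasDerivAt_iff_tendsto_slope.1 h).mono_left
      (nhdsGT_le_nhdsNE 0)
    refine this.congr fun t => ?_
    simp [slope_def_field, h0]
  have he : ∀ c : ℝ, HasDerivAt (fun t => Real.exp (c * t)) c 0 := fun c => by
    simpa using ((hasDerivAt_id (0:ℝ)).const_mul c).exp
  have hid := hasDerivAt_id' (0:ℝ)
  have hnu : HasDerivAt (nuF β σ) σ 0 := by
    have := (((he (2 * β)).sub_const 1).const_mul σ).div_const (2 * β)
    exact this.congr_deriv (by field_simp)
  have hmu : HasDerivAt (muF β γ σ) (-2 * γ) 0 := by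
    have h1 := (he β).const_sub 1
    have := (((h1.div_const β).pow 2).const_mul σ).add ((h1.const_mul (2 * γ)).div_const β)
    have h : HasDerivAt (muF β γ σ) _ 0 := this
    exact h.congr_deriv (by simp; field_simp)
  have hlam : HasDerivAt (lamF α β γ σ) α 0 := by
    have h1 := ((((he (2 * β)).sub ((he β).const_mul 4)).add_const 3).div_const
      (2 * β ^ 3)).add (hid.div_const (β ^ 2))
    have h2 := ((hid.const_mul 2).div_const β).sub
      ((((he β).sub_const 1).const_mul 2).div_const (β ^ 2))
    have := ((hid.const_mul α).add (h1.const_mul σ)).add (h2.const_mul γ)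
    have h : HasDerivAt (lamF α β γ σ) _ 0 := this
    exact h.congr_deriv (by field_simp; ring)
  have tn := slope hnu (by simp [nuF])
  have tm := slope hmu (by simp [muF])
  have tl := slope hlam (by simp [lamF]; norm_num)
  have tf : Tendsto (fun t => fF α β γ σ t / t ^ 2) (nhdsWithin 0 (Set.Ioi 0))
      (nhds (4 * (α * σ - γ ^ 2))) := by
    have := ((tl.const_mul 4).mul tn).sub (tm.pow 2)
    convert! this.congr' ?_ using 2
    · ring
    · filter_upwards [self_mem_nhdsWithin] with t ht
      have : t ≠ 0 := ne_of_gt ht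
      rw [fF]; field_simp
  set M := max |σ| (max |α| |-2 * γ|) + 1 with hM
  have hMσ : |σ| < M := by
    have := le_max_left |σ| (max |α| |-2 * γ|); linarith
  have hMα : |α| < M := by
    have := (le_max_left |α| |-2 * γ|).trans (le_max_right |σ| _); linarith
  have hMγ : |-2 * γ| < M := by
    have := (le_max_right |α| |-2 * γ|).trans (le_max_right |σ| _); linarith
  have hd : 2 * (α * σ - γ ^ 2) < 4 * (α * σ - γ ^ 2) := by linarith
  have ev : ∀ᶠ t in nhdsWithin (0:ℝ) (Set.Ioi 0), 0 < nuF β σ t ∧ |nuF β σ t| ≤ M * t ∧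
      |lamF α β γ σ t| ≤ M * t ∧ |muF β γ σ t| ≤ M * t ∧
      2 * (α * σ - γ ^ 2) * t ^ 2 ≤ fF α β γ σ t := by
    filter_upwards [self_mem_nhdsWithin, tn.eventually_const_lt hσ,
      tn.abs.eventually_lt_const hMσ, tl.abs.eventually_lt_const hMα,
      tm.abs.eventually_lt_const hMγ, tf.eventually_const_lt hd] with t ht a1 a2 a3 a4 a5
    have ht : 0 < t := ht
    rw [abs_div, abs_of_pos ht, div_lt_iff₀ ht] at a2 a3 a4
    rw [lt_div_iff₀ (by positivity)] at a5
    exact ⟨(div_pos_iff_of_pos_right ht).1 a1, a2.le, a3.le, a4.le, a5.le⟩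
  obtain ⟨T, hT, hsub⟩ := mem_nhdsGT_iff_exists_Ioc_subset.1 ev
  exact ⟨M, (abs_nonneg _).trans_lt hMσ, 2 * (α * σ - γ ^ 2), by linarith, T, hT,
    fun t h0 h1 => hsub ⟨h0, h1⟩⟩

lemma phaseGaussian_anti {j k : ℝ} (h : j ≤ k) (z : E3 × E3) :
    phaseGaussian k z ≤ phaseGaussian j z :=
  Real.exp_le_exp.2 (mul_le_mul_of_nonneg_right (neg_le_neg h) (by positivity))

/-- Gaussian bounds for the profile `F(t)` and its gradient, for small times. -/
lemma exists_profile_bounds (α β γ σ : ℝ) (hσ : 0 < σ) (hβ : 0 < β) (hcoeff : γ^2 < α*σ) :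
    ∃ C : ℝ, 0 < C ∧ ∃ k : ℝ, 0 < k ∧ ∃ T : ℝ, 0 < T ∧ T ≤ 1 ∧ ∀ t, 0 < t → t ≤ T →
      ContDiff ℝ 1 (fun z : E3 × E3 => FF α β γ σ t z.1 z.2) ∧ ∀ z : E3 × E3,
        |FF α β γ σ t z.1 z.2| ≤ C * (t⁻¹ ^ 3 * phaseGaussian (k / t) z) ∧
        ‖fderiv ℝ (fun z : E3 × E3 => FF α β γ σ t z.1 z.2) z‖ * (1 + ‖z.2‖ ^ 2) ≤
          C * t ^ (-(1:ℝ)/2) * (t⁻¹ ^ 3 * phaseGaussian (k / t) z) := by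
  obtain ⟨M, hM, d, hd, T, hT, hb⟩ := exists_coefficient_bounds α β γ σ hσ hβ hcoeff
  set k : ℝ := 1 / (8 * M) with hk
  have hk0 : 0 < k := by positivity
  set K : ℝ := ((2*π)^3)⁻¹ * d ^ (-(3:ℝ)/2) with hK
  have hK0 : 0 < K := by positivity
  set L : ℝ := 6 * M / d * (1 + 4 / k) ^ 2 with hL
  have hL0 : 0 < L := by positivity
  refine ⟨K + K * L, by positivity, k / 2, by positivity, min T 1, by positivity,
    min_le_right _ _, fun t ht htT => ?_⟩
  have ht1 : t ≤ 1 := htT.trans (min_le_right _ _)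
  obtain ⟨hn, hnM, hlM, hmM, hfd⟩ := hb t ht (htT.trans (min_le_left _ _))
  have hfd0 : 0 < d * t ^ 2 := by positivity
  have hf : 0 < fF α β γ σ t := hfd0.trans_le hfd
  have hamp : ((2*π)^3)⁻¹ * (fF α β γ σ t) ^ (-(3:ℝ)/2) ≤ K * t⁻¹ ^ 3 := by
    have h1 := Real.rpow_le_rpow_of_nonpos hfd0 hfd (by norm_num : -(3:ℝ)/2 ≤ 0)
    have h2 : (t ^ 2) ^ (-(3:ℝ)/2) = t⁻¹ ^ 3 := by
      rw [← Real.rpow_natCast, ← Real.rpow_mul ht.le, inv_pow, ← Real.rpow_natCast,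
        ← Real.rpow_neg ht.le]
      norm_num
    rw [Real.mul_rpow hd.le (by positivity), h2] at h1
    rw [hK, mul_assoc]
    gcongr
  set Q := quadExp (nuF β σ t) (lamF α β γ σ t) (muF β γ σ t) (fF α β γ σ t) with hQ
  have hFF : (fun z : E3 × E3 => FF α β γ σ t z.1 z.2)
      = fun z => ((2*π)^3)⁻¹ * (fF α β γ σ t) ^ (-(3:ℝ)/2) * Real.exp (Q z) := rfl
  have hQd : ContDiff ℝ 1 Q := contDiff_quadExp _ _ _ _
  have hexp : ∀ z, Real.exp (Q z) ≤ phaseGaussian (k / t) z := by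
    intro z
    refine Real.exp_le_exp.2 ((quadExp_le hf rfl hn z).trans ?_)
    have hlpos : 0 < lamF α β γ σ t := by
      by_contra! h
      have : fF α β γ σ t ≤ 0 := by
        rw [fF]
        nlinarith [sq_nonneg (muF β γ σ t), mul_nonneg hn.le (neg_nonneg.2 h)]
      linarith
    have : k / t ≤ 1 / (4 * (nuF β σ t + lamF α β γ σ t)) := by
      rw [hk, div_div]
      refine one_div_le_one_div_of_le (by positivity) ?_
      rw [abs_of_pos hn] at hnM
      rw [abs_of_pos hlpos] at hlM
      linarith
    gcongr
  have hval : ∀ z : E3 × E3,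
      |FF α β γ σ t z.1 z.2| ≤ K * t⁻¹ ^ 3 * phaseGaussian (k / t) z := by
    intro z
    have h : FF α β γ σ t z.1 z.2 = _ := congrFun hFF z
    rw [h, abs_of_nonneg (by positivity)]
    gcongr
    exact hexp z
  have hcd : ContDiff ℝ 1 (fun z : E3 × E3 => FF α β γ σ t z.1 z.2) := by
    rw [hFF]; exact contDiff_const.mul hQd.exp
  refine ⟨hcd, fun z => ⟨?_, ?_⟩⟩
  · calc |FF α β γ σ t z.1 z.2| ≤ K * t⁻¹ ^ 3 * phaseGaussian (k / t) z := hval z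
      _ ≤ K * t⁻¹ ^ 3 * phaseGaussian (k / 2 / t) z := by
        gcongr; exact phaseGaussian_anti (by gcongr; linarith) z
      _ ≤ (K + K * L) * (t⁻¹ ^ 3 * phaseGaussian (k / 2 / t) z) := by
        have := phaseGaussian_pos (k / 2 / t) z
        rw [mul_assoc]
        gcongr
        nlinarith [mul_pos hK0 hL0]
  · have hder : fderiv ℝ (fun z : E3 × E3 => FF α β γ σ t z.1 z.2) z
        = FF α β γ σ t z.1 z.2 • fderiv ℝ Q z := by
      have h1 : HasFDerivAt Q (fderiv ℝ Q z) z := (hQd.differentiable (by norm_num) z).hasFDerivAt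
      have h2 := h1.exp.const_mul (((2*π)^3)⁻¹ * (fF α β γ σ t) ^ (-(3:ℝ)/2))
      rw [hFF, h2.fderiv, smul_smul]
      rfl
    have hQ' : ‖fderiv ℝ Q z‖ ≤ 6 * M / d * t⁻¹ * ‖z‖ := by
      refine (norm_fderiv_quadExp_le _ _ _ hf z).trans ?_
      gcongr
      calc 2 * (|nuF β σ t| + |lamF α β γ σ t| + |muF β γ σ t|) / fF α β γ σ t
          ≤ 2 * (M * t + M * t + M * t) / (d * t ^ 2) := by gcongr
        _ = _ := by field_simp; ring
    have hsqrt : t⁻¹ * Real.sqrt t = t ^ (-(1:ℝ)/2) := by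
      rw [Real.sqrt_eq_rpow, ← Real.rpow_neg_one, ← Real.rpow_add ht]; norm_num
    have := phaseGaussian_pos (k / t) z
    have := phaseGaussian_pos (k / 2 / t) z
    rw [hder, norm_smul, Real.norm_eq_abs]
    calc |FF α β γ σ t z.1 z.2| * ‖fderiv ℝ Q z‖ * (1 + ‖z.2‖ ^ 2)
        ≤ (K * t⁻¹ ^ 3 * phaseGaussian (k / t) z) * (6 * M / d * t⁻¹ * ‖z‖)
            * (1 + ‖z.2‖ ^ 2) := by gcongr; exact hval z
      _ = K * t⁻¹ ^ 3 * (6 * M / d * t⁻¹)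
            * (‖z‖ * (1 + ‖z.2‖ ^ 2) * phaseGaussian (k / t) z) := by ring
      _ ≤ K * t⁻¹ ^ 3 * (6 * M / d * t⁻¹)
            * ((1 + 4 / k) ^ 2 * Real.sqrt t * phaseGaussian (k / 2 / t) z) := by
          exact mul_le_mul_of_nonneg_left (norm_mul_weight_mul_phaseGaussian_le hk0 ht ht1 z)
            (by positivity)
      _ = K * L * (t⁻¹ * Real.sqrt t) * (t⁻¹ ^ 3 * phaseGaussian (k / 2 / t) z) := by
          rw [hL]; ring
      _ ≤ _ := by
          rw [hsqrt]
          gcongr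
          linarith

lemma integrable_sq_of_Xnorm_lt_top {w : E3 × E3 → ℝ} (hw : Measurable w) (hX : Xnorm w < ⊤) :
    Integrable fun q => w q ^ 2 := by
  refine ⟨(hw.pow_const 2).aestronglyMeasurable, ?_⟩
  have hfin := (ENNReal.rpow_lt_top_iff_of_pos (by norm_num)).1 hX
  refine lt_of_le_of_lt (lintegral_mono fun q => ?_) hfin
  rw [enorm_pow]
  refine le_mul_of_one_le_right zero_le ?_
  rw [ENNReal.one_le_ofReal]
  exact one_le_pow₀ (by linarith [sq_nonneg ‖q.2‖])

/-- Peetre's inequality for the weight `1 + |v|²`. -/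
lemma one_add_norm_sq_le (u v : E3) :
    1 + ‖u‖ ^ 2 ≤ 2 * (1 + ‖u - v‖ ^ 2) * (1 + ‖v‖ ^ 2) := by
  have h : ‖u‖ ≤ ‖u - v‖ + ‖v‖ := by simpa using norm_add_le (u - v) v
  nlinarith [norm_nonneg u, norm_nonneg v, norm_nonneg (u - v), sq_nonneg (‖u - v‖ - ‖v‖),
    mul_nonneg (sq_nonneg ‖u - v‖) (sq_nonneg ‖v‖)]

/-- Weighted `L²` bound for anything dominated by the sheared gradient of a convolution with a
kernel whose weighted gradient is dominated by a Gaussian. -/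
lemma weighted_norm_le_of_le_fderiv {φ : E3 × E3 → ℝ} (hφ : ContDiff ℝ 1 φ) {A C j : ℝ}
    (hA : 0 ≤ A) (hj : 0 < j) (hb : ∀ z, |φ z| ≤ C * phaseGaussian j z)
    (hb' : ∀ z, ‖fderiv ℝ φ z‖ * (1 + ‖z.2‖ ^ 2) ≤ A * phaseGaussian j z)
    {w : E3 × E3 → ℝ} (hw : Measurable w) (hX : Xnorm w < ⊤) {c e L : ℝ} (he : 1 ≤ e)
    (hL : 0 ≤ L) {g : E3 × E3 → ℝ} (hg0 : ∀ p, 0 ≤ g p)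
    (hg : ∀ p, g p ≤ L * ‖fderiv ℝ (fun z => ∫ q, φ (z - q) * w q) (shear c e p)‖) :
    (∫⁻ p : E3 × E3, ENNReal.ofReal (g p ^ 2 * (1 + ‖p.2‖ ^ 2) ^ 2)) ^ (1/2 : ℝ) ≤
      ENNReal.ofReal (2 * L * A * (π / j) ^ 3) * Xnorm w := by
  have hder : ∀ z, fderiv ℝ (fun z => ∫ q, φ (z - q) * w q) z
      = ∫ q, w q • fderiv ℝ φ (z - q) := fun z =>
    (hasFDerivAt_integral_sub_mul hφ hj (C := |C| + A)
      (fun z => (hb z).trans (by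
        have := phaseGaussian_pos j z
        gcongr; linarith [le_abs_self C]))
      (fun z => (le_mul_of_one_le_right (norm_nonneg _)
        (by linarith [sq_nonneg ‖z.2‖])).trans ((hb' z).trans (by
        have := phaseGaussian_pos j z
        gcongr; linarith [abs_nonneg C])))
      hw (integrable_sq_of_Xnorm_lt_top hw hX) z).fderiv
  set G : E3 × E3 → ℝ≥0∞ := fun z => ENNReal.ofReal (2 * L * A * phaseGaussian j z) with hG
  have hGm : Measurable G :=
    ((continuous_phaseGaussian j).measurable.const_mul _).ennreal_ofReal
  have hGi : ∫⁻ z, G z = ENNReal.ofReal (2 * L * A * (π / j) ^ 3) := by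
    simp_rw [hG, ENNReal.ofReal_mul (by positivity : 0 ≤ 2 * L * A)]
    rw [lintegral_const_mul _ (continuous_phaseGaussian j).measurable.ennreal_ofReal,
      lintegral_phaseGaussian hj]
  set h : E3 × E3 → ℝ≥0∞ := fun q => ENNReal.ofReal (|w q| * (1 + ‖q.2‖ ^ 2)) with hh
  have hhm : Measurable h :=
    (hw.abs.mul ((measurable_snd.norm.pow_const 2).const_add 1)).ennreal_ofReal
  have hh2 : ∀ q, h q ^ 2 = (‖w q‖₊ : ℝ≥0∞) ^ 2 * ENNReal.ofReal ((1 + ‖q.2‖ ^ 2) ^ 2) := by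
    intro q
    simp only [hh]
    rw [ENNReal.ofReal_mul (abs_nonneg _), mul_pow, ENNReal.ofReal_pow (by positivity),
      ← Real.norm_eq_abs, ofReal_norm]
    rfl
  have hrow : ∀ p, ∫⁻ q, G (shear c e p - q) ≤ ENNReal.ofReal (2 * L * A * (π / j) ^ 3) := by
    intro p
    rw [← hGi]
    have : ∀ q, G (shear c e p - q) = G (q - shear c e p) := fun q => by
      simp only [hG, phaseGaussian_sub_comm]
    simp_rw [this]
    exact (lintegral_sub_right_eq_self G _).le
  have hcol : ∀ q, ∫⁻ p, G (shear c e p - q) ≤ ENNReal.ofReal (2 * L * A * (π / j) ^ 3) :=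
    fun q => (lintegral_shear_sub_le c he hGm q).trans_eq hGi
  have hpt : ∀ p, ENNReal.ofReal (g p ^ 2 * (1 + ‖p.2‖ ^ 2) ^ 2)
      ≤ (∫⁻ q, G (shear c e p - q) * h q) ^ 2 := by
    intro p
    rw [← mul_pow, ENNReal.ofReal_pow (mul_nonneg (hg0 p) (by positivity))]
    refine pow_le_pow_left' ?_ 2
    set z := shear c e p with hz
    have hW : 1 + ‖p.2‖ ^ 2 ≤ 1 + ‖z.2‖ ^ 2 := by
      have : ‖z.2‖ = e * ‖p.2‖ := by
        rw [hz, shear, norm_smul, Real.norm_eq_abs, abs_of_pos (by positivity)]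
      rw [this]
      gcongr
      exact le_mul_of_one_le_left (norm_nonneg _) he
    calc ENNReal.ofReal (g p * (1 + ‖p.2‖ ^ 2))
        ≤ ENNReal.ofReal ((L * (1 + ‖z.2‖ ^ 2)) * ‖∫ q, w q • fderiv ℝ φ (z - q)‖) := by
          refine ENNReal.ofReal_le_ofReal ?_
          calc g p * (1 + ‖p.2‖ ^ 2)
              ≤ (L * ‖∫ q, w q • fderiv ℝ φ (z - q)‖) * (1 + ‖z.2‖ ^ 2) := by
                have := hg p
                rw [hder] at this
                gcongr
            _ = _ := by ring
      _ ≤ ENNReal.ofReal (L * (1 + ‖z.2‖ ^ 2)) * ∫⁻ q, ‖w q • fderiv ℝ φ (z - q)‖ₑ := by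
          rw [ENNReal.ofReal_mul (by positivity), ofReal_norm]
          gcongr
          exact enorm_integral_le_lintegral_enorm _
      _ = ∫⁻ q, ENNReal.ofReal (L * (1 + ‖z.2‖ ^ 2)) * ‖w q • fderiv ℝ φ (z - q)‖ₑ := by
          rw [lintegral_const_mul' _ _ ENNReal.ofReal_ne_top]
      _ ≤ ∫⁻ q, G (z - q) * h q := by
          refine lintegral_mono fun q => ?_
          simp only [hG, hh]
          have hgp := phaseGaussian_pos j (z - q)
          rw [← ofReal_norm, ← ENNReal.ofReal_mul (by positivity),
            ← ENNReal.ofReal_mul (by positivity), norm_smul, Real.norm_eq_abs]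
          refine ENNReal.ofReal_le_ofReal ?_
          have h1 : 1 + ‖z.2‖ ^ 2 ≤ 2 * (1 + ‖(z - q).2‖ ^ 2) * (1 + ‖q.2‖ ^ 2) :=
            one_add_norm_sq_le z.2 q.2
          calc L * (1 + ‖z.2‖ ^ 2) * (|w q| * ‖fderiv ℝ φ (z - q)‖)
              ≤ L * (2 * (1 + ‖(z - q).2‖ ^ 2) * (1 + ‖q.2‖ ^ 2))
                  * (|w q| * ‖fderiv ℝ φ (z - q)‖) := by gcongr
            _ = 2 * L * (‖fderiv ℝ φ (z - q)‖ * (1 + ‖(z - q).2‖ ^ 2))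
                  * (|w q| * (1 + ‖q.2‖ ^ 2)) := by ring
            _ ≤ 2 * L * (A * phaseGaussian j (z - q)) * (|w q| * (1 + ‖q.2‖ ^ 2)) := by
                have := hb' (z - q)
                gcongr
            _ = _ := by ring
  have hmain := (lintegral_mono hpt).trans (lintegral_sq_lintegral_mul_le
    (k := fun p q => G (shear c e p - q))
    (hGm.comp (((continuous_shear c e).measurable.comp measurable_fst).sub measurable_snd))
    hhm hrow hcol)
  simp_rw [hh2] at hmain
  calc _ ≤ (ENNReal.ofReal (2 * L * A * (π / j) ^ 3) ^ 2 * ∫⁻ q : E3 × E3,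
        (‖w q‖₊ : ℝ≥0∞) ^ 2 * ENNReal.ofReal ((1 + ‖q.2‖ ^ 2) ^ 2)) ^ (1/2 : ℝ) := by
        gcongr
    _ = _ := by
        rw [ENNReal.mul_rpow_of_nonneg _ _ (by norm_num), ← ENNReal.rpow_natCast,
          ← ENNReal.rpow_mul, Xnorm]
        norm_num

/-- Prop. 3.1 (parabolic regularization): there are `B, T₀ > 0` such that the solution of
the linear WFP equation satisfies
`‖∇_v w(t)‖_X ≤ B t^{−1/2} e^{κt} ‖w₀‖_X` and `‖∇_x w(t)‖_X ≤ B t^{−1/2} e^{κt} ‖w₀‖_X`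
for `0 < t ≤ T₀`, with `κ = 3β/2 + 9σ`. -/
theorem parabolic_regularization (α β γ σ : ℝ) (hα : 0 ≤ α) (hγ : 0 ≤ γ) (hσ : 0 < σ)
    (hβ : 0 < β) (hcoeff : γ^2 < α*σ) :
    ∃ B : ℝ, 0 < B ∧ ∃ T₀ : ℝ, 0 < T₀ ∧
      ∀ w₀ : E3 × E3 → ℝ, Measurable w₀ → Xnorm w₀ < ⊤ →
        ∀ t : ℝ, 0 < t → t ≤ T₀ →
          (∀ x v : E3,
            DifferentiableAt ℝ (fun x' : E3 => sol α β γ σ w₀ t x' v) x ∧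
            DifferentiableAt ℝ (fun v' : E3 => sol α β γ σ w₀ t x v') v) ∧
          ((∫⁻ p : E3 × E3, ENNReal.ofReal
              (‖gradient (fun v' : E3 => sol α β γ σ w₀ t p.1 v') p.2‖ ^ 2 *
                (1 + ‖p.2‖ ^ 2) ^ 2)) ^ (1/2 : ℝ) ≤
            ENNReal.ofReal (B * t ^ (-(1:ℝ)/2) * Real.exp ((3*β/2 + 9*σ) * t)) * Xnorm w₀) ∧
          ((∫⁻ p : E3 × E3, ENNReal.ofReal
              (‖gradient (fun x' : E3 => sol α β γ σ w₀ t x' p.2) p.1‖ ^ 2 *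
                (1 + ‖p.2‖ ^ 2) ^ 2)) ^ (1/2 : ℝ) ≤
            ENNReal.ofReal (B * t ^ (-(1:ℝ)/2) * Real.exp ((3*β/2 + 9*σ) * t)) * Xnorm w₀) := by
  obtain ⟨C, hC, k, hk, T, hT, hT1, hF⟩ := exists_profile_bounds α β γ σ hσ hβ hcoeff
  set S : ℝ := Real.exp (3 * β) * (Real.exp β / β + Real.exp β) with hS
  have hS0 : 0 < S := by positivity
  refine ⟨2 * S * C * (π / k) ^ 3, by positivity, T, hT, fun w hw hX t ht htT => ?_⟩
  obtain ⟨hφ, hb⟩ := hF t ht htT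
  set φ : E3 × E3 → ℝ := fun z => FF α β γ σ t z.1 z.2 with hφdef
  set Φ : E3 × E3 → ℝ := fun z => ∫ q, φ (z - q) * w q with hΦ
  set e := Real.exp (β * t) with he
  set c := (1 - e) / β with hc
  have he1 : 1 ≤ e := Real.one_le_exp (by positivity)
  have heβ : e ≤ Real.exp β := Real.exp_le_exp.2 (by nlinarith)
  have he3 : Real.exp (3 * β * t) ≤ Real.exp (3 * β) := Real.exp_le_exp.2 (by nlinarith)
  have hcβ : |c| ≤ Real.exp β / β := by
    rw [hc, abs_div, abs_of_pos hβ, abs_of_nonpos (by linarith)]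
    gcongr
    linarith
  have hsol : ∀ p : E3 × E3, sol α β γ σ w t p.1 p.2
      = Real.exp (3 * β * t) * Φ (shear c e p) := by
    intro p
    rw [hΦ, ← integral_const_mul]
    exact integral_congr_ae (Eventually.of_forall fun q => mul_assoc _ _ _)
  have hj : 0 < k / t := by positivity
  have hder : ∀ z, HasFDerivAt Φ (fderiv ℝ Φ z) z := fun z =>
    (hasFDerivAt_integral_sub_mul hφ hj (C := C * t⁻¹ ^ 3 + C * t ^ (-(1:ℝ)/2) * t⁻¹ ^ 3)
      (fun z => (hb z).1.trans (by
        have := phaseGaussian_pos (k / t) z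
        rw [← mul_assoc]; gcongr; linarith [show 0 < C * t ^ (-(1:ℝ)/2) * t⁻¹ ^ 3 by positivity]))
      (fun z => (le_mul_of_one_le_right (norm_nonneg _)
          (by linarith [sq_nonneg ‖z.2‖])).trans ((hb z).2.trans (by
        have := phaseGaussian_pos (k / t) z
        rw [← mul_assoc]; gcongr; linarith [show 0 < C * t⁻¹ ^ 3 by positivity])))
      hw (integrable_sq_of_Xnorm_lt_top hw hX) z).differentiableAt.hasFDerivAt
  have hx : ∀ p : E3 × E3, HasFDerivAt (fun x' : E3 => sol α β γ σ w t x' p.2)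
      (Real.exp (3 * β * t) • (fderiv ℝ Φ (shear c e p)).comp
        (ContinuousLinearMap.inl ℝ E3 E3)) p.1 := by
    intro p
    have h1 : HasFDerivAt (fun x' : E3 => shear c e (x', p.2))
        (ContinuousLinearMap.inl ℝ E3 E3) p.1 :=
      ((hasFDerivAt_id p.1).add_const (c • p.2)).prodMk (hasFDerivAt_const (e • p.2) p.1)
    have h2 := ((hder (shear c e p)).comp p.1 h1).const_mul (Real.exp (3 * β * t))
    exact h2.congr_of_eventuallyEq (Eventually.of_forall fun x' => hsol (x', p.2))
  have hv : ∀ p : E3 × E3, HasFDerivAt (fun v' : E3 => sol α β γ σ w t p.1 v')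
      (Real.exp (3 * β * t) • (fderiv ℝ Φ (shear c e p)).comp
        ((c • ContinuousLinearMap.id ℝ E3).prod (e • ContinuousLinearMap.id ℝ E3))) p.2 := by
    intro p
    have h1 : HasFDerivAt (fun v' : E3 => shear c e (p.1, v'))
        ((c • ContinuousLinearMap.id ℝ E3).prod (e • ContinuousLinearMap.id ℝ E3)) p.2 :=
      (((hasFDerivAt_id p.2).const_smul c).const_add p.1).prodMk
        ((hasFDerivAt_id p.2).const_smul e)
    have h2 := ((hder (shear c e p)).comp p.2 h1).const_mul (Real.exp (3 * β * t))
    exact h2.congr_of_eventuallyEq (Eventually.of_forall fun v' => hsol (p.1, v'))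
  have hgrad : ∀ (u : E3 → ℝ) (u' : E3 →L[ℝ] ℝ) (y : E3), HasFDerivAt u u' y →
      ‖gradient u y‖ = ‖u'‖ := fun u u' y h => by
    rw [gradient, LinearIsometryEquiv.norm_map, h.fderiv]
  have hbound : ∀ (A : (E3 →L[ℝ] E3 × E3)), ‖A‖ ≤ Real.exp β / β + Real.exp β → ∀ p,
      ‖Real.exp (3 * β * t) • (fderiv ℝ Φ (shear c e p)).comp A‖
        ≤ S * ‖fderiv ℝ Φ (shear c e p)‖ := by
    intro A hA p
    rw [norm_smul, Real.norm_eq_abs, Real.abs_exp]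
    calc Real.exp (3 * β * t) * ‖(fderiv ℝ Φ (shear c e p)).comp A‖
        ≤ Real.exp (3 * β) * (‖fderiv ℝ Φ (shear c e p)‖ *
            (Real.exp β / β + Real.exp β)) := by
          gcongr
          exact (ContinuousLinearMap.opNorm_comp_le _ _).trans (by gcongr)
      _ = _ := by rw [hS]; ring
  have hinl : ‖ContinuousLinearMap.inl ℝ E3 E3‖ ≤ Real.exp β / β + Real.exp β := by
    refine (ContinuousLinearMap.norm_inl_le_one ℝ E3 E3).trans ?_
    have : 0 < Real.exp β / β := by positivity
    linarith
  have hcol : ‖(c • ContinuousLinearMap.id ℝ E3).prod (e • ContinuousLinearMap.id ℝ E3)‖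
      ≤ Real.exp β / β + Real.exp β := by
    refine ContinuousLinearMap.opNorm_le_bound _ (by positivity) fun y => ?_
    have h1 : ‖c • y‖ ≤ Real.exp β / β * ‖y‖ := by
      rw [norm_smul, Real.norm_eq_abs]; gcongr
    have h2 : ‖e • y‖ ≤ Real.exp β * ‖y‖ := by
      rw [norm_smul, Real.norm_eq_abs, abs_of_pos (by positivity)]; gcongr
    have h3 : 0 ≤ Real.exp β / β * ‖y‖ := by positivity
    have h4 : 0 ≤ Real.exp β * ‖y‖ := by positivity
    rw [add_mul]
    exact max_le (by simpa using by linarith) (by simpa using by linarith)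
  have hconst : 2 * S * (C * t ^ (-(1:ℝ)/2) * t⁻¹ ^ 3) * (π / (k / t)) ^ 3
      ≤ 2 * S * C * (π / k) ^ 3 * t ^ (-(1:ℝ)/2) * Real.exp ((3*β/2 + 9*σ) * t) := by
    have h1 : 2 * S * (C * t ^ (-(1:ℝ)/2) * t⁻¹ ^ 3) * (π / (k / t)) ^ 3
        = 2 * S * C * (π / k) ^ 3 * t ^ (-(1:ℝ)/2) := by field_simp
    rw [h1]
    exact le_mul_of_one_le_right (by positivity) (Real.one_le_exp (by positivity))
  have key : ∀ g : E3 × E3 → ℝ, (∀ p, 0 ≤ g p) →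
      (∀ p, g p ≤ S * ‖fderiv ℝ Φ (shear c e p)‖) →
      (∫⁻ p : E3 × E3, ENNReal.ofReal (g p ^ 2 * (1 + ‖p.2‖ ^ 2) ^ 2)) ^ (1/2 : ℝ) ≤
        ENNReal.ofReal (2 * S * C * (π / k) ^ 3 * t ^ (-(1:ℝ)/2) *
          Real.exp ((3*β/2 + 9*σ) * t)) * Xnorm w := fun g hg0 hg =>
    (weighted_norm_le_of_le_fderiv hφ (A := C * t ^ (-(1:ℝ)/2) * t⁻¹ ^ 3) (by positivity) hj
      (C := C * t⁻¹ ^ 3) (fun z => (hb z).1.trans_eq (mul_assoc _ _ _).symm)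
      (fun z => (hb z).2.trans_eq (mul_assoc _ _ _).symm) hw hX he1 hS0.le hg0 hg).trans
      (mul_le_mul_left (ENNReal.ofReal_le_ofReal hconst) _)
  refine ⟨fun x v => ⟨(hx (x, v)).differentiableAt, (hv (x, v)).differentiableAt⟩,
    key _ (fun p => norm_nonneg _) fun p => ?_, key _ (fun p => norm_nonneg _) fun p => ?_⟩
  · rw [hgrad _ _ _ (hv p)]
    exact hbound _ hcol p
  · rw [hgrad _ _ _ (hx p)]
    exact hbound _ hinl p

end
end
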